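/- arXiv:gr-qc/0002034 — 2 statements merged into one kernel-verified Lean document; each statement's English description precedes it below -/
import Mathlib

section
/- Fix α > 1 and let (A, C) be a maximal solution of the limiting system with A(0) = 1, C(0) = α, crashing at ȳ (i.e., A > 0 on [0, ȳ) and lim_{y→ȳ⁻} A(y) = 0). Then the improper integral ∫₀^{ȳ} y²(1 − A(y) C(y)²)/(A(y) C(y)) dy is strictly positive. -/
open Real Set Filter Topology MeasureTheory

noncomputable section

/-- The mini-boson-star ODE system for `f, A, C` on a set `s ⊆ (0, ∞)`
(prime denotes `d/dx`):
`(x² f'/C)' = (x²/(A C))·(1 − A C²)·f`,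
`A' = (1 − A)/x − x·(A f'² + A C² f² + f²)`,
`C' = (C/(x A))·(A − 1 + x² f²)`, with `A > 0` and `C > 0`. -/
def MiniBosonSystem (f A C : ℝ → ℝ) (s : Set ℝ) : Prop :=
  ∀ x ∈ s, 0 < x ∧ 0 < A x ∧ 0 < C x ∧
    DifferentiableAt ℝ f x ∧ DifferentiableAt ℝ (deriv f) x ∧
    DifferentiableAt ℝ A x ∧ DifferentiableAt ℝ C x ∧
    deriv (fun y => y ^ 2 * deriv f y / C y) x
      = x ^ 2 / (A x * C x) * (1 - A x * C x ^ 2) * f x ∧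
    deriv A x = (1 - A x) / x
      - x * (A x * deriv f x ^ 2 + A x * C x ^ 2 * f x ^ 2 + f x ^ 2) ∧
    deriv C x = C x / (x * A x) * (A x - 1 + x ^ 2 * f x ^ 2)

/-- A domain of the form `[0, x̄)` with `0 < x̄ ≤ ∞`. -/
def IsOrbitDomain (s : Set ℝ) : Prop :=
  s = Set.Ici (0 : ℝ) ∨ ∃ xbar > (0 : ℝ), s = Set.Ico 0 xbar

/-- An `a`-orbit of the mini-boson-star system with parameters `a, α` on the
domain `s = [0, x̄)`: a solution of the system on `s \ {0}`, continuous up to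
`x = 0` with `f` differentiable at `0`, satisfying `f 0 = a`, `f' 0 = 0`,
`A 0 = 1`, `C 0 = α`. -/
def IsAOrbit (f A C : ℝ → ℝ) (a α : ℝ) (s : Set ℝ) : Prop :=
  IsOrbitDomain s ∧
  MiniBosonSystem f A C (s \ {0}) ∧
  ContinuousWithinAt f s 0 ∧ ContinuousWithinAt A s 0 ∧ ContinuousWithinAt C s 0 ∧
  HasDerivWithinAt f 0 s 0 ∧
  f 0 = a ∧ A 0 = 1 ∧ C 0 = α

/-- The mass function `M(x) = x (1 − A x)/2`. -/
def massFn (A : ℝ → ℝ) (x : ℝ) : ℝ := x * (1 - A x) / 2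

/-- `θ` is the rotation function of the orbit with scalar field `f`:
`θ` is continuous on the domain, `θ 0 = 0`, and for every `x` in the domain
there is `ρ x > 0` with `f x = ρ x · cos (θ x)` and `f' x = −ρ x · sin (θ x)`. -/
def IsRotation (f θ : ℝ → ℝ) (s : Set ℝ) : Prop :=
  ContinuousOn θ s ∧ θ 0 = 0 ∧
  ∀ x ∈ s, ∃ ρ > (0 : ℝ), f x = ρ * Real.cos (θ x) ∧ deriv f x = -(ρ * Real.sin (θ x))

/-- The limiting system (large central amplitude limit of the mini-boson-star
system) for `A, C` on a set `s ⊆ (0, ∞)` (prime denotes `d/dy`):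
`A' = (1 − A)/y − y·(1 + A C²)`, `C' = (C/(y A))·(A − 1 + y²)`,
with `A > 0` and `C > 0`. -/
def LimitSystem (A C : ℝ → ℝ) (s : Set ℝ) : Prop :=
  ∀ y ∈ s, 0 < y ∧ 0 < A y ∧ 0 < C y ∧
    DifferentiableAt ℝ A y ∧ DifferentiableAt ℝ C y ∧
    deriv A y = (1 - A y) / y - y * (1 + A y * C y ^ 2) ∧
    deriv C y = C y / (y * A y) * (A y - 1 + y ^ 2)

/-- A solution of the limiting system on the domain `s = [0, ȳ)`, continuous up
to `y = 0`, with `A 0 = 1` and `C 0 = α`. -/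
def IsLimitOrbit (A C : ℝ → ℝ) (α : ℝ) (s : Set ℝ) : Prop :=
  IsOrbitDomain s ∧
  LimitSystem A C (s \ {0}) ∧
  ContinuousWithinAt A s 0 ∧ ContinuousWithinAt C s 0 ∧
  A 0 = 1 ∧ C 0 = α

/-- A barrier principle: a function that starts nonnegative and has nonnegative derivative wherever
it is negative stays nonnegative. -/
lemma nonneg_of_deriv_nonneg_of_neg {g g' : ℝ → ℝ} {a b : ℝ} (hab : a ≤ b)
    (hc : ContinuousOn g (Icc a b)) (hd : ∀ y ∈ Ioo a b, HasDerivAt g (g' y) y)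
    (ha : 0 ≤ g a) (h : ∀ y ∈ Ioo a b, g y < 0 → 0 ≤ g' y) : 0 ≤ g b := by
  by_contra! hb
  set S : Set ℝ := Icc a b ∩ g ⁻¹' Ici 0 with hS
  have hScl : IsClosed S := hc.preimage_isClosed_of_isClosed isClosed_Icc isClosed_Ici
  have hSne : S.Nonempty := ⟨a, ⟨le_rfl, hab⟩, ha⟩
  have hSbdd : BddAbove S := ⟨b, fun y hy => hy.1.2⟩
  obtain ⟨⟨has, hsb⟩, hs0⟩ := hScl.csSup_mem hSne hSbdd
  set s := sSup S with hs
  have hs0' : 0 ≤ g s := hs0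
  have hneg : ∀ y ∈ Ioo s b, g y < 0 := by
    intro y hy
    by_contra! hy0
    exact absurd (le_csSup hSbdd (⟨⟨has.trans hy.1.le, hy.2.le⟩, hy0⟩ : y ∈ S)) (not_le.2 hy.1)
  have hmono : MonotoneOn g (Icc s b) := by
    refine monotoneOn_of_hasDerivWithinAt_nonneg (f' := g') (convex_Icc s b)
      (hc.mono (Icc_subset_Icc_left has)) ?_ ?_
    · intro y hy
      rw [interior_Icc] at hy
      exact (hd y ⟨has.trans_lt hy.1, hy.2⟩).hasDerivWithinAt
    · intro y hy
      rw [interior_Icc] at hy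
      exact h y ⟨has.trans_lt hy.1, hy.2⟩ (hneg y hy)
  linarith [hmono ⟨le_rfl, hsb⟩ ⟨hsb, le_rfl⟩ hsb]

/-- A continuous function that goes from below `v` to at least `v` has a first hitting point. -/
lemma exists_first_hit {f : ℝ → ℝ} {a b v : ℝ} (hab : a ≤ b) (hc : ContinuousOn f (Icc a b))
    (ha : f a < v) (hb : v ≤ f b) :
    ∃ c ∈ Ioc a b, f c = v ∧ ∀ y ∈ Ico a c, f y < v := by
  set S : Set ℝ := Icc a b ∩ f ⁻¹' Ici v with hS
  have hScl : IsClosed S := hc.preimage_isClosed_of_isClosed isClosed_Icc isClosed_Ici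
  have hSne : S.Nonempty := ⟨b, ⟨hab, le_rfl⟩, hb⟩
  have hSbdd : BddBelow S := ⟨a, fun y hy => hy.1.1⟩
  obtain ⟨⟨hac, hcb⟩, hcv⟩ := hScl.csInf_mem hSne hSbdd
  set c := sInf S with hcdef
  have hcv' : v ≤ f c := hcv
  have hlt : ∀ y ∈ Ico a c, f y < v := by
    intro y hy
    by_contra! hy0
    exact absurd (csInf_le hSbdd (⟨⟨hy.1, hy.2.le.trans hcb⟩, hy0⟩ : y ∈ S)) (not_le.2 hy.2)
  have hac' : a < c := by
    rcases hac.eq_or_lt with h | h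
    · rw [← h] at hcv'; linarith
    · exact h
  refine ⟨c, ⟨hac', hcb⟩, ?_, hlt⟩
  obtain ⟨d, hd, hdv⟩ := intermediate_value_Icc hac (hc.mono (Icc_subset_Icc_right hcb))
    ⟨ha.le, hcv'⟩
  rcases hd.2.eq_or_lt with h | h
  · rw [← h]; exact hdv
  · exact absurd hdv (hlt d ⟨hd.1, h⟩).ne

/-- The lower boundary of the trapping region, as a polynomial inequality. -/
lemma early_lower_barrier {n p a : ℝ} (hn : 0 < n) (hn3 : n ≤ 1 / 3) (hp : 0 < p)
    (hp' : p < 3 * n * (1 - n)) (ha : 0 < a) (han : a ≤ 1 - n) :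
    0 ≤ p * (2 - 3 * n - p) - (3 - 6 * n) * (p - n) * a := by
  have h1 : 0 ≤ 2 - 3 * n - p := by nlinarith
  rcases le_total p n with h | h
  · have : 0 ≤ (3 - 6 * n) * (n - p) * a := by
      apply mul_nonneg (mul_nonneg _ _) ha.le <;> linarith
    nlinarith
  · have h2 : (3 - 6 * n) * (p - n) * a ≤ (3 - 6 * n) * (p - n) * (1 - n) := by
      apply mul_le_mul_of_nonneg_left han (mul_nonneg _ _) <;> linarith
    set k := 3 * n * (1 - n) with hk
    have hk0 : 0 < k := by rw [hk]; apply mul_pos <;> linarith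
    have key : 0 ≤ k * (p * (2 - 3 * n - p) - (3 - 6 * n) * (p - n) * (1 - n)) := by
      have e : k * (p * (2 - 3 * n - p) - (3 - 6 * n) * (p - n) * (1 - n))
          = p * (3 * n ^ 2 * (1 - n) * (1 - 3 * n)) + (k - p) * ((3 - 6 * n) * n * (1 - n))
            + k * p * (k - p) := by rw [hk]; ring
      rw [e]
      have : 0 ≤ 1 - 3 * n := by linarith
      have : 0 ≤ 1 - n := by linarith
      have : 0 ≤ 3 - 6 * n := by linarith
      have : 0 ≤ k - p := by linarith
      positivity
    nlinarith [nonneg_of_mul_nonneg_right key hk0]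

lemma late_lower_barrier {n p a : ℝ} (hn : 0 < n) (hn' : n ≤ 59 / 100) (hp : 0 < p)
    (hpl : p < 23 / 100 + 8 / 5 * (59 / 100 - n) ^ 2) (ha : 0 < a) (han : a ≤ 1 - n) :
    0 ≤ (2 - 3 * n - p) * (23 / 100 + 8 / 5 * (59 / 100 - n) ^ 2)
      + 16 / 5 * (59 / 100 - n) * (p - n) * a := by
  obtain ⟨u, rfl⟩ : ∃ u, n = 59 / 100 - u := ⟨59 / 100 - n, by ring⟩
  have hu : 0 ≤ u := by linarith
  have hu' : u < 59 / 100 := by linarith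
  have e : 59 / 100 - (59 / 100 - u) = u := by ring
  rw [e] at hpl ⊢
  set l := 23 / 100 + 8 / 5 * u ^ 2 with hl
  have hl0 : 0 < l := by positivity
  have h1 : 0 ≤ 2 - 3 * (59 / 100 - u) - p := by nlinarith
  rcases le_total (59 / 100 - u) p with h | h
  · have h2 : 0 ≤ p - (59 / 100 - u) := by linarith
    positivity
  · have h2 : 16 / 5 * u * ((59 / 100 - u) - p) * a
        ≤ 16 / 5 * u * ((59 / 100 - u) - p) * (41 / 100 + u) := by
      apply mul_le_mul_of_nonneg_left (by linarith) (mul_nonneg (by positivity) (by linarith))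
    have h3 : 0 ≤ l * ((2 - 3 * (59 / 100 - u) - p) * l
        - 16 / 5 * u * ((59 / 100 - u) - p) * (41 / 100 + u)) := by
      have e : l * ((2 - 3 * (59 / 100 - u) - p) * l
          - 16 / 5 * u * ((59 / 100 - u) - p) * (41 / 100 + u))
          = (l - p) * ((23 / 100 + 3 * u) * l - 16 / 5 * u * (59 / 100 - u) * (41 / 100 + u))
          + p * ((23 / 100 + 3 * u - l) * l
            - 16 / 5 * u * (59 / 100 - u - l) * (41 / 100 + u)) := by ring
      rw [e]
      have t1 : 0 ≤ (23 / 100 + 3 * u) * l - 16 / 5 * u * (59 / 100 - u) * (41 / 100 + u) := by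
        rw [hl]
        nlinarith [mul_nonneg hu hu, mul_nonneg hu (mul_nonneg hu hu), sq_nonneg (u - 1 / 10)]
      have t2 : 0 ≤ (23 / 100 + 3 * u - l) * l
            - 16 / 5 * u * (59 / 100 - u - l) * (41 / 100 + u) := by
        have : (23 / 100 + 3 * u - l) * l
            - 16 / 5 * u * (59 / 100 - u - l) * (41 / 100 + u)
            = u * ((3 - 8 / 5 * u) * l - 16 / 5 * (59 / 100 - u - l) * (41 / 100 + u)) := by
          rw [hl]; ring
        rw [this]
        apply mul_nonneg hu
        rw [hl]
        nlinarith [mul_nonneg hu hu, mul_nonneg hu (mul_nonneg hu hu), sq_nonneg (u - 1 / 10)]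
      have : 0 ≤ l - p := by linarith
      positivity
    nlinarith [nonneg_of_mul_nonneg_right h3 hl0]

/-- The cubic profile `n ↦ 3n/2 + 11n³/2` bounding `3 - p/n` from below. -/
def cubicProfile (n : ℝ) : ℝ := 3 / 2 * n + 11 / 2 * n ^ 3

/-- A polynomial inequality on `[0, cubicProfile n]` follows from the values at the endpoints of
its tangent line at `t`. -/
lemma upper_barrier_of_tangent {n x s t : ℝ} (hn : 0 < n) (hx : 0 ≤ x) (hxh : x ≤ cubicProfile n)
    (h0 : 0 ≤ 2 * ((3 - 3 * n - 22 * n ^ 3) * (1 - s * n)) - 6 + 18 * n - n * t ^ 2)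
    (h1 : 0 ≤ 2 * ((3 - 3 * n - 22 * n ^ 3) * (1 - s * n)) - 6 + 18 * n
      + (2 - 9 * n - (3 - 3 * n - 22 * n ^ 3) * (1 - s * n)) * cubicProfile n
      + n * (2 * t * cubicProfile n - t ^ 2)) :
    0 ≤ (3 - 3 * n - 22 * n ^ 3) * (2 - x) * (1 - s * n) - (3 - x) * (2 - 6 * n + n * x) := by
  have hh : 0 < cubicProfile n := by unfold cubicProfile; positivity
  set h := cubicProfile n
  have key : 0 ≤ h * ((3 - 3 * n - 22 * n ^ 3) * (2 - x) * (1 - s * n)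
      - (3 - x) * (2 - 6 * n + n * x)) := by
    have e : h * ((3 - 3 * n - 22 * n ^ 3) * (2 - x) * (1 - s * n)
        - (3 - x) * (2 - 6 * n + n * x))
        = (h - x) * (2 * ((3 - 3 * n - 22 * n ^ 3) * (1 - s * n)) - 6 + 18 * n - n * t ^ 2)
          + x * (2 * ((3 - 3 * n - 22 * n ^ 3) * (1 - s * n)) - 6 + 18 * n
            + (2 - 9 * n - (3 - 3 * n - 22 * n ^ 3) * (1 - s * n)) * h
            + n * (2 * t * h - t ^ 2)) + h * (n * (x - t) ^ 2) := by ring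
    rw [e]
    have : 0 ≤ h - x := by linarith
    positivity
  exact nonneg_of_mul_nonneg_right key hh

lemma upper_barrier_aux_low {n x : ℝ} (hn : 0 < n) (hn' : n ≤ 2 / 5) (hx : 0 ≤ x)
    (hxh : x ≤ cubicProfile n) (s : ℝ) (hs : s = 1 ∨ s = 100 / 59) :
    0 ≤ (3 - 3 * n - 22 * n ^ 3) * (2 - x) * (1 - s * n) - (3 - x) * (2 - 6 * n + n * x) := by
  have hv : 0 ≤ 2 / 5 - n := by linarith
  have b : ∀ i j : ℕ, 0 ≤ n * (n ^ i * (2 / 5 - n) ^ j) := fun i j => by positivity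
  apply upper_barrier_of_tangent (t := cubicProfile n) hn hx hxh <;> unfold cubicProfile <;>
  rcases hs with rfl | rfl <;>
  linarith [b 0 6, b 1 5, b 2 4, b 3 3, b 4 2, b 5 1, b 6 0]

lemma upper_barrier_aux_high {n x : ℝ} (hn : 2 / 5 ≤ n) (hn' : n ≤ 59 / 100) (hx : 0 ≤ x)
    (hxh : x ≤ cubicProfile n) (s : ℝ) (hs : s = 1 ∨ s = 100 / 59) :
    0 ≤ (3 - 3 * n - 22 * n ^ 3) * (2 - x) * (1 - s * n) - (3 - x) * (2 - 6 * n + n * x) := by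
  have hn0 : 0 < n := by linarith
  have hu : 0 ≤ n - 2 / 5 := by linarith
  have hv : 0 ≤ 59 / 100 - n := by linarith
  have b : ∀ i j : ℕ, 0 ≤ n * ((n - 2 / 5) ^ i * (59 / 100 - n) ^ j) := fun i j => by positivity
  apply upper_barrier_of_tangent (t := 4 * n - 3 / 5) hn0 hx hxh
  · rcases hs with rfl | rfl <;>
    linarith [b 0 6, b 1 5, b 2 4, b 3 3, b 4 2, b 5 1, b 6 0]
  · unfold cubicProfile
    rcases hs with rfl | rfl <;>
    linarith [b 0 6, b 1 5, b 2 4, b 3 3, b 4 2, b 5 1, b 6 0]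

lemma upper_barrier {n x Y : ℝ} (hn : 0 < n) (hn' : n ≤ 59 / 100) (hx : 0 ≤ x)
    (hxh : x ≤ cubicProfile n) (hY : 0 ≤ Y) (hYn : Y ≤ 123 / 59 * n) :
    0 ≤ (3 - 3 * n - 22 * n ^ 3) * (2 - x) * (1 - n - Y / 3)
      - (3 - x) * (2 - 6 * n + n * x) := by
  have aux : ∀ s : ℝ, s = 1 ∨ s = 100 / 59 →
      0 ≤ (3 - 3 * n - 22 * n ^ 3) * (2 - x) * (1 - s * n) - (3 - x) * (2 - 6 * n + n * x) := by
    intro s hs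
    rcases le_total n (2 / 5) with h | h
    · exact upper_barrier_aux_low hn h hx hxh s hs
    · exact upper_barrier_aux_high h hn' hx hxh s hs
  have h0 := aux 1 (Or.inl rfl)
  have h1 := aux (100 / 59) (Or.inr rfl)
  have hk : 0 < 123 / 59 * n := by positivity
  have key : 0 ≤ (123 / 59 * n) * ((3 - 3 * n - 22 * n ^ 3) * (2 - x) * (1 - n - Y / 3)
      - (3 - x) * (2 - 6 * n + n * x)) := by
    have e : (123 / 59 * n) * ((3 - 3 * n - 22 * n ^ 3) * (2 - x) * (1 - n - Y / 3)
        - (3 - x) * (2 - 6 * n + n * x))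
        = (123 / 59 * n - Y) * ((3 - 3 * n - 22 * n ^ 3) * (2 - x) * (1 - 1 * n)
            - (3 - x) * (2 - 6 * n + n * x))
          + Y * ((3 - 3 * n - 22 * n ^ 3) * (2 - x) * (1 - 100 / 59 * n)
            - (3 - x) * (2 - 6 * n + n * x)) := by ring
    rw [e]
    have : 0 ≤ 123 / 59 * n - Y := by linarith
    positivity
  exact nonneg_of_mul_nonneg_right key hk

/-- The limiting system in the variables `N = 1 - A - y²/3` and `P = y² A C²` on `[0, b)`. -/
structure ReducedFlow (N P : ℝ → ℝ) (b : ℝ) : Prop where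
  contN : ContinuousOn N (Ico 0 b)
  contP : ContinuousOn P (Ico 0 b)
  N_zero : N 0 = 0
  P_zero : P 0 = 0
  A_pos : ∀ y ∈ Ioo 0 b, 0 < 1 - N y - y ^ 2 / 3
  P_pos : ∀ y ∈ Ioo 0 b, 0 < P y
  derivN : ∀ y ∈ Ioo 0 b, HasDerivAt N ((P y - N y) / y) y
  derivP : ∀ y ∈ Ioo 0 b,
    HasDerivAt P (P y * (2 - 3 * N y - P y) / (y * (1 - N y - y ^ 2 / 3))) y
  start : ∃ k > (1 / 3 : ℝ), ∀ᶠ y in 𝓝[>] 0, 3 * k * y ^ 2 ≤ P y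

namespace ReducedFlow

variable {N P : ℝ → ℝ} {b c : ℝ}

lemma contN_Icc (hF : ReducedFlow N P b) (hc : c < b) {a : ℝ} (ha : 0 ≤ a) :
    ContinuousOn N (Icc a c) :=
  hF.contN.mono fun _ hy => ⟨ha.trans hy.1, hy.2.trans_lt hc⟩

lemma contP_Icc (hF : ReducedFlow N P b) (hc : c < b) {a : ℝ} (ha : 0 ≤ a) :
    ContinuousOn P (Icc a c) :=
  hF.contP.mono fun _ hy => ⟨ha.trans hy.1, hy.2.trans_lt hc⟩

lemma exists_quadratic_le (hF : ReducedFlow N P b) (hb : 0 < b) :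
    ∃ k > (1 / 3 : ℝ), ∃ δ ∈ Ioo 0 b, ∀ y ∈ Ioc 0 δ, k * y ^ 2 ≤ N y := by
  obtain ⟨k, hk, hev⟩ := hF.start
  obtain ⟨δ, hδ, hsub⟩ := mem_nhdsGT_iff_exists_Ioc_subset.1 hev
  have hδ0 : 0 < δ := hδ
  refine ⟨k, hk, min δ (b / 2), ⟨by positivity, (min_le_right _ _).trans_lt (by linarith)⟩, ?_⟩
  intro y hy
  have hyδ : y ≤ δ := hy.2.trans (min_le_left _ _)
  have hyb : y < b := (hy.2.trans (min_le_right _ _)).trans_lt (by linarith)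
  have h := nonneg_of_deriv_nonneg_of_neg (g := fun t => t * N t - k * t ^ 3)
    (g' := fun t => P t - 3 * k * t ^ 2) hy.1.le
    ((continuousOn_id.mul (hF.contN_Icc hyb le_rfl)).sub (by fun_prop)) ?_ (by simp) ?_
  · have hy0 := hy.1
    have e : y * N y - k * y ^ 3 = y * (N y - k * y ^ 2) := by ring
    simp only [e] at h
    linarith [nonneg_of_mul_nonneg_right h hy0]
  · intro t ht
    have ht0 : t ≠ 0 := ht.1.ne'
    refine (((hasDerivAt_id t).mul (hF.derivN t ⟨ht.1, ht.2.trans hyb⟩)).sub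
      ((hasDerivAt_pow 3 t).const_mul k)).congr_deriv ?_
    field_simp; norm_num; ring
  · intro t ht _
    have := hsub (⟨ht.1, ht.2.le.trans hyδ⟩ : t ∈ Ioc 0 δ)
    have this : 3 * k * t ^ 2 ≤ P t := this
    linarith

lemma N_pos (hF : ReducedFlow N P b) {y : ℝ} (hy : y ∈ Ioo 0 b) : 0 < N y := by
  obtain ⟨k, hk, δ, hδ, h⟩ := hF.exists_quadratic_le (hy.1.trans hy.2)
  set a := min δ y with ha
  have ha0 : 0 < a := lt_min hδ.1 hy.1
  have hNa := h a ⟨ha0, min_le_left _ _⟩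
  have hNa0 : 0 < N a := lt_of_lt_of_le (by positivity) hNa
  have h := nonneg_of_deriv_nonneg_of_neg (g := fun t => t * N t - a * N a)
    (g' := fun t => P t) (min_le_right δ y)
    ((continuousOn_id.mul (hF.contN_Icc hy.2 ha0.le)).sub (by fun_prop)) ?_ (by simp [ha]) ?_
  · have : 0 < y * N y := by
      have := mul_pos ha0 hNa0
      linarith
    exact pos_of_mul_pos_right this hy.1.le
  · intro t ht
    have ht0 : 0 < t := ha0.trans ht.1
    refine (((hasDerivAt_id t).mul (hF.derivN t ⟨ht0, ht.2.trans hy.2⟩)).sub_const _).congr_deriv ?_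
    simp only [id]; field_simp; ring
  · intro t ht _
    exact (hF.P_pos t ⟨ha0.trans ht.1, ht.2.trans hy.2⟩).le

lemma P_le_three_mul_N (hF : ReducedFlow N P b) (hc : c ∈ Ioo 0 b)
    (hg : ∀ y ∈ Ioo 0 c, y ^ 2 / 6 < N y) : P c ≤ 3 * N c := by
  have h := nonneg_of_deriv_nonneg_of_neg (g := fun t => 3 * N t - P t)
    (g' := fun t => 3 * ((P t - N t) / t)
      - P t * (2 - 3 * N t - P t) / (t * (1 - N t - t ^ 2 / 3))) hc.1.le
    ((continuousOn_const.mul (hF.contN_Icc hc.2 le_rfl)).sub (hF.contP_Icc hc.2 le_rfl)) ?_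
    (by simp [hF.N_zero, hF.P_zero]) ?_
  · linarith
  · intro t ht
    have htb : t ∈ Ioo 0 b := ⟨ht.1, ht.2.trans hc.2⟩
    exact ((hF.derivN t htb).const_mul 3).sub (hF.derivP t htb)
  · intro t ht hneg
    have htb : t ∈ Ioo 0 b := ⟨ht.1, ht.2.trans hc.2⟩
    have hA := hF.A_pos t htb
    have hP := hF.P_pos t htb
    have hgt := hg t ht
    have ht0 := ht.1
    have hAN : 1 - 3 * N t ≤ 1 - N t - t ^ 2 / 3 := by linarith
    generalize hAdef : 1 - N t - t ^ 2 / 3 = A at *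
    have e : 3 * ((P t - N t) / t) - P t * (2 - 3 * N t - P t) / (t * A)
        = (3 * (P t - N t) * A - P t * (2 - 3 * N t - P t)) / (t * A) := by
      field_simp
    simp only [e]
    apply div_nonneg _ (by positivity)
    have h1 : 2 * P t * A ≤ 3 * (P t - N t) * A :=
      mul_le_mul_of_nonneg_right (by linarith) hA.le
    have h2 : P t * (2 - 3 * N t - P t) ≤ P t * (2 * A) :=
      mul_le_mul_of_nonneg_left (by linarith) hP.le
    linarith

lemma P_le_one (hF : ReducedFlow N P b) (hc : c ∈ Ioo 0 b)
    (hg : ∀ y ∈ Ioo 0 c, y ^ 2 / 6 < N y) : P c ≤ 1 := by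
  have h := nonneg_of_deriv_nonneg_of_neg (g := fun t => 1 - P t)
    (g' := fun t => - (P t * (2 - 3 * N t - P t) / (t * (1 - N t - t ^ 2 / 3)))) hc.1.le
    (continuousOn_const.sub (hF.contP_Icc hc.2 le_rfl)) ?_
    (by simp [hF.P_zero]) ?_
  · linarith
  · intro t ht
    exact (hF.derivP t ⟨ht.1, ht.2.trans hc.2⟩).const_sub 1
  · intro t ht hneg
    have htb : t ∈ Ioo 0 b := ⟨ht.1, ht.2.trans hc.2⟩
    have hA := hF.A_pos t htb
    have hP := hF.P_pos t htb
    have hW := hF.P_le_three_mul_N htb fun y hy => hg y ⟨hy.1, hy.2.trans ht.2⟩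
    have ht0 := ht.1
    rw [← neg_div]
    apply div_nonneg _ (by positivity)
    have : 0 ≤ P t * (P t + 3 * N t - 2) := mul_nonneg hP.le (by linarith)
    linarith

lemma early_le_P (hF : ReducedFlow N P b) (hc : c ∈ Ioo 0 b)
    (hN : ∀ y ∈ Ioo 0 c, N y ≤ 1 / 3) : 3 * N c * (1 - N c) ≤ P c := by
  have cN := hF.contN_Icc hc.2 le_rfl
  have h := nonneg_of_deriv_nonneg_of_neg (g := fun t => P t - 3 * N t * (1 - N t))
    (g' := fun t => P t * (2 - 3 * N t - P t) / (t * (1 - N t - t ^ 2 / 3))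
      - (3 - 6 * N t) * ((P t - N t) / t)) hc.1.le
    ((hF.contP_Icc hc.2 le_rfl).sub ((continuousOn_const.mul cN).mul (continuousOn_const.sub cN)))
    ?_ (by simp [hF.P_zero, hF.N_zero]) ?_
  · linarith
  · intro t ht
    have htb : t ∈ Ioo 0 b := ⟨ht.1, ht.2.trans hc.2⟩
    have dN := hF.derivN t htb
    refine ((hF.derivP t htb).sub ((dN.const_mul 3).mul (dN.const_sub 1))).congr_deriv ?_
    ring
  · intro t ht hneg
    have htb : t ∈ Ioo 0 b := ⟨ht.1, ht.2.trans hc.2⟩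
    have hA := hF.A_pos t htb
    have ht0 := ht.1
    have key := early_lower_barrier (hF.N_pos htb) (hN t ht) (hF.P_pos t htb) (by linarith) hA
      (by nlinarith)
    have e : P t * (2 - 3 * N t - P t) / (t * (1 - N t - t ^ 2 / 3))
      - (3 - 6 * N t) * ((P t - N t) / t) = (P t * (2 - 3 * N t - P t)
        - (3 - 6 * N t) * (P t - N t) * (1 - N t - t ^ 2 / 3)) / (t * (1 - N t - t ^ 2 / 3)) := by
      generalize 1 - N t - t ^ 2 / 3 = A at *; field_simp
    rw [e]
    positivity

lemma hasDerivAt_ratio (hF : ReducedFlow N P b) {t : ℝ} (ht : t ∈ Ioo 0 b) :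
    HasDerivAt (fun t => N t / t ^ 2) ((P t - 3 * N t) / t ^ 3) t := by
  have ht0 : t ≠ 0 := ht.1.ne'
  refine ((hF.derivN t ht).div (hasDerivAt_pow 2 t) (pow_ne_zero 2 ht0)).congr_deriv ?_
  field_simp; norm_num; ring

lemma early_lt_N (hF : ReducedFlow N P b) (hc : c ∈ Ioo 0 b)
    (hN : ∀ y ∈ Ioc 0 c, N y ≤ 1 / 3) : c ^ 2 / 6 < N c := by
  obtain ⟨k, hk, δ, hδ, hs⟩ := hF.exists_quadratic_le (hc.1.trans hc.2)
  set a := min δ c with ha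
  have ha0 : 0 < a := lt_min hδ.1 hc.1
  have hNa := hs a ⟨ha0, min_le_left _ _⟩
  have hNa0 : 0 < N a := lt_of_lt_of_le (by positivity) hNa
  have cN := hF.contN_Icc hc.2 ha0.le
  have h := nonneg_of_deriv_nonneg_of_neg
    (g := fun t => N t / t ^ 2 + 3 * (k / 2) * N t - k)
    (g' := fun t => (P t - 3 * N t) / t ^ 3 + 3 * (k / 2) * ((P t - N t) / t)) (min_le_right δ c)
    (((cN.div (by fun_prop) fun t ht => pow_ne_zero 2 (ha0.trans_le ht.1).ne').add
      (continuousOn_const.mul cN)).sub continuousOn_const) ?_ ?_ ?_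
  · have h3 := hN c ⟨hc.1, le_rfl⟩
    have hc2 : 0 < c ^ 2 := by have := hc.1; positivity
    have h4 : k / 2 ≤ N c / c ^ 2 := by
      have : k * N c ≤ k * (1 / 3) := mul_le_mul_of_nonneg_left h3 (by linarith)
      linarith
    rw [le_div_iff₀ hc2] at h4
    nlinarith
  · intro t ht
    have htb : t ∈ Ioo 0 b := ⟨ha0.trans ht.1, ht.2.trans hc.2⟩
    exact ((hF.hasDerivAt_ratio htb).add ((hF.derivN t htb).const_mul _)).sub_const _
  · have h1 : k ≤ N a / a ^ 2 := by rwa [le_div_iff₀ (by positivity)]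
    have : 0 < 3 * (k / 2) * N a := by positivity
    linarith
  · intro t ht hneg
    have ht0 : 0 < t := ha0.trans ht.1
    have htb : t ∈ Ioo 0 b := ⟨ht0, ht.2.trans hc.2⟩
    have hE := hF.early_le_P htb fun y hy => hN y ⟨hy.1, (hy.2.trans ht.2).le⟩
    have hNp := hF.N_pos htb
    have e : (P t - 3 * N t) / t ^ 3 + 3 * (k / 2) * ((P t - N t) / t)
        = ((P t - 3 * N t * (1 - N t)) / t ^ 2 + 3 * (k / 2) * (P t - 3 * N t * (1 - N t))
          + 3 * N t * (-(N t / t ^ 2 + 3 * (k / 2) * N t - k))) / t := by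
      field_simp; ring
    rw [e]
    have h1 : 0 ≤ P t - 3 * N t * (1 - N t) := by linarith
    have h2 : 0 ≤ -(N t / t ^ 2 + 3 * (k / 2) * N t - k) := by linarith
    positivity

lemma ratio_antitone (hF : ReducedFlow N P b) (hc : c ∈ Ioo 0 b)
    (hg : ∀ y ∈ Ioo 0 c, y ^ 2 / 6 < N y) {y : ℝ} (hy : y ∈ Ioc 0 c) :
    N c * y ^ 2 ≤ N y * c ^ 2 := by
  have hy0 := hy.1
  have hc0 := hc.1
  have h := nonneg_of_deriv_nonneg_of_neg (g := fun t => N y / y ^ 2 - N t / t ^ 2)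
    (g' := fun t => - ((P t - 3 * N t) / t ^ 3)) hy.2
    (continuousOn_const.sub ((hF.contN_Icc hc.2 hy0.le).div (by fun_prop)
      fun t ht => pow_ne_zero 2 (hy0.trans_le ht.1).ne')) ?_ (by simp) ?_
  · have h' : N c / c ^ 2 ≤ N y / y ^ 2 := by linarith
    rwa [div_le_div_iff₀ (by positivity) (by positivity)] at h'
  · intro t ht
    exact (hF.hasDerivAt_ratio ⟨hy0.trans ht.1, ht.2.trans hc.2⟩).const_sub _
  · intro t ht _
    have ht0 : 0 < t := hy0.trans ht.1
    have hW := hF.P_le_three_mul_N ⟨ht0, ht.2.trans hc.2⟩ fun z hz => hg z ⟨hz.1, hz.2.trans ht.2⟩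
    rw [← neg_div]
    apply div_nonneg _ (by positivity)
    linarith

lemma P_le_profile (hF : ReducedFlow N P b) (hc : c ∈ Ioo 0 b)
    (hg : ∀ y ∈ Ioo 0 c, y ^ 2 / 6 < N y) (hN : ∀ y ∈ Ioo 0 c, N y ≤ 59 / 100)
    (hY : ∀ y ∈ Ioo 0 c, y ^ 2 ≤ 123 / 59 * N y) : P c ≤ N c * (3 - cubicProfile (N c)) := by
  have cN := hF.contN_Icc hc.2 le_rfl
  have h := nonneg_of_deriv_nonneg_of_neg
    (g := fun t => N t * (3 - (3 / 2 * N t + 11 / 2 * N t ^ 3)) - P t)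
    (g' := fun t => (3 - 3 * N t - 22 * N t ^ 3) * ((P t - N t) / t)
      - P t * (2 - 3 * N t - P t) / (t * (1 - N t - t ^ 2 / 3))) hc.1.le
    ((cN.mul (continuousOn_const.sub ((continuousOn_const.mul cN).add
      (continuousOn_const.mul (cN.pow 3))))).sub (hF.contP_Icc hc.2 le_rfl)) ?_
    (by simp [hF.P_zero, hF.N_zero]) ?_
  · unfold cubicProfile; linarith
  · intro t ht
    have htb : t ∈ Ioo 0 b := ⟨ht.1, ht.2.trans hc.2⟩
    have dN := hF.derivN t htb
    refine ((dN.mul (((dN.const_mul (3 / 2)).add ((dN.pow 3).const_mul (11 / 2))).const_sub 3)).sub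
      (hF.derivP t htb)).congr_deriv ?_
    norm_num; ring
  · intro t ht hneg
    have htb : t ∈ Ioo 0 b := ⟨ht.1, ht.2.trans hc.2⟩
    have hA := hF.A_pos t htb
    have hNp := hF.N_pos htb
    have ht0 := ht.1
    have hW := hF.P_le_three_mul_N htb fun z hz => hg z ⟨hz.1, hz.2.trans ht.2⟩
    obtain ⟨x, hx⟩ : ∃ x, P t = N t * (3 - x) := ⟨3 - P t / N t, by field_simp; ring⟩
    have hx0 : 0 ≤ x := by
      rw [hx] at hW
      have : N t * (3 - x) ≤ N t * 3 := by linarith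
      linarith [le_of_mul_le_mul_left this hNp]
    have hxh : x ≤ cubicProfile (N t) := by
      unfold cubicProfile
      rw [hx] at hneg
      have : N t * (3 - (3 / 2 * N t + 11 / 2 * N t ^ 3)) ≤ N t * (3 - x) := by linarith
      linarith [le_of_mul_le_mul_left this hNp]
    have key := upper_barrier hNp (hN t ht) hx0 hxh (sq_nonneg t) (hY t ht)
    have e : (3 - 3 * N t - 22 * N t ^ 3) * ((P t - N t) / t)
      - P t * (2 - 3 * N t - P t) / (t * (1 - N t - t ^ 2 / 3))
        = N t * ((3 - 3 * N t - 22 * N t ^ 3) * (2 - x) * (1 - N t - t ^ 2 / 3)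
      - (3 - x) * (2 - 6 * N t + N t * x)) / (t * (1 - N t - t ^ 2 / 3)) := by
      rw [hx]; generalize 1 - N t - t ^ 2 / 3 = A at *; field_simp; ring
    rw [e]
    positivity

lemma N_le (hF : ReducedFlow N P b) (hc : c ∈ Ioo 0 b)
    (hg : ∀ y ∈ Ioo 0 c, y ^ 2 / 6 < N y) : N c ≤ 59 / 100 := by
  by_contra! hN
  obtain ⟨d, hd, hNd, hlt⟩ := exists_first_hit hc.1.le (hF.contN_Icc hc.2 le_rfl)
    (by norm_num [hF.N_zero]) hN.le
  have hdb : d ∈ Ioo 0 b := ⟨hd.1, hd.2.trans_lt hc.2⟩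
  have hY : ∀ y ∈ Ioc 0 c, y ^ 2 ≤ 123 / 59 * N y := by
    intro y hy
    have h1 := hF.ratio_antitone hc hg hy
    have h2 := hF.A_pos c hc
    have h3 := hF.N_pos ⟨hy.1, hy.2.trans_lt hc.2⟩
    have h4 : N y * c ^ 2 ≤ N y * (123 / 100) := mul_le_mul_of_nonneg_left (by linarith) h3.le
    have h5 : 59 / 100 * y ^ 2 ≤ N c * y ^ 2 := mul_le_mul_of_nonneg_right hN.le (sq_nonneg y)
    linarith
  have h := nonneg_of_deriv_nonneg_of_neg (g := fun t => 589 / 1000 - N t)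
    (g' := fun t => - ((P t - N t) / t)) hd.1.le
    (continuousOn_const.sub (hF.contN_Icc hdb.2 le_rfl)) ?_ (by norm_num [hF.N_zero]) ?_
  · norm_num [hNd] at h
  · intro t ht
    exact (hF.derivN t ⟨ht.1, ht.2.trans hdb.2⟩).const_sub _
  · intro t ht hneg
    have htb : t ∈ Ioo 0 b := ⟨ht.1, ht.2.trans hdb.2⟩
    have htc : t < c := ht.2.trans_le hd.2
    have hP := hF.P_le_profile htb (fun y hy => hg y ⟨hy.1, hy.2.trans htc⟩)
      (fun y hy => (hlt y ⟨hy.1.le, hy.2.trans ht.2⟩).le)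
      (fun y hy => hY y ⟨hy.1, (hy.2.trans htc).le⟩)
    have hNt : 589 / 1000 < N t := by linarith
    have hcube : (589 / 1000 : ℝ) ^ 3 ≤ N t ^ 3 := pow_le_pow_left₀ (by norm_num) hNt.le 3
    have hprof : 2 ≤ cubicProfile (N t) := by
      unfold cubicProfile; norm_num at hcube ⊢; linarith
    have : N t * (3 - cubicProfile (N t)) ≤ N t * 1 :=
      mul_le_mul_of_nonneg_left (by linarith) (by linarith)
    rw [← neg_div]
    exact div_nonneg (by linarith) ht.1.le

lemma late_le_P (hF : ReducedFlow N P b) (hc : c ∈ Ioo 0 b)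
    (hg : ∀ y ∈ Ioo 0 c, y ^ 2 / 6 < N y) {d : ℝ} (hd : d ∈ Ioc 0 c) (hNd : N d = 1 / 3)
    (hN : ∀ y ∈ Ioo 0 d, N y ≤ 1 / 3) :
    23 / 100 + 8 / 5 * (59 / 100 - N c) ^ 2 ≤ P c := by
  have cN := hF.contN_Icc hc.2 hd.1.le
  have hL : ∀ n : ℝ, 0 < 23 / 100 + 8 / 5 * (59 / 100 - n) ^ 2 := fun n => by positivity
  have h := nonneg_of_deriv_nonneg_of_neg
    (g := fun t => P t / (23 / 100 + 8 / 5 * (59 / 100 - N t) ^ 2) - 1)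
    (g' := fun t => P t * ((2 - 3 * N t - P t) * (23 / 100 + 8 / 5 * (59 / 100 - N t) ^ 2)
      + 16 / 5 * (59 / 100 - N t) * (P t - N t) * (1 - N t - t ^ 2 / 3))
      / (t * (1 - N t - t ^ 2 / 3)) / (23 / 100 + 8 / 5 * (59 / 100 - N t) ^ 2) ^ 2) hd.2
    (((hF.contP_Icc hc.2 hd.1.le).div (continuousOn_const.add (continuousOn_const.mul
      ((continuousOn_const.sub cN).pow 2))) fun t _ => (hL _).ne').sub continuousOn_const) ?_ ?_ ?_
  · have h' : 1 ≤ P c / (23 / 100 + 8 / 5 * (59 / 100 - N c) ^ 2) := by linarith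
    rwa [le_div_iff₀ (hL _), one_mul] at h'
  · intro t ht
    have ht0 : 0 < t := hd.1.trans ht.1
    have htb : t ∈ Ioo 0 b := ⟨ht0, ht.2.trans hc.2⟩
    have hA := hF.A_pos t htb
    refine (((hF.derivP t htb).div (((((hF.derivN t htb).const_sub (59 / 100)).pow 2).const_mul
      (8 / 5)).const_add (23 / 100)) (hL (N t)).ne').sub_const 1).congr_deriv ?_
    congr 1
    generalize 1 - N t - t ^ 2 / 3 = A at *
    field_simp
    norm_num
    ring
  · have hP := hF.early_le_P ⟨hd.1, hd.2.trans_lt hc.2⟩ hN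
    rw [hNd] at hP
    have : 1 ≤ P d / (23 / 100 + 8 / 5 * (59 / 100 - N d) ^ 2) := by
      rw [le_div_iff₀ (hL _), hNd]; norm_num at hP ⊢; linarith
    linarith
  · intro t ht hneg
    have ht0 : 0 < t := hd.1.trans ht.1
    have htb : t ∈ Ioo 0 b := ⟨ht0, ht.2.trans hc.2⟩
    have hA := hF.A_pos t htb
    have hP := hF.P_pos t htb
    have hlt : P t / (23 / 100 + 8 / 5 * (59 / 100 - N t) ^ 2) < 1 := by linarith
    rw [div_lt_one (hL _)] at hlt
    have key := late_lower_barrier (hF.N_pos htb)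
      (hF.N_le htb fun y hy => hg y ⟨hy.1, hy.2.trans ht.2⟩) hP hlt hA (by nlinarith)
    positivity

lemma late_le_N (hF : ReducedFlow N P b) (hc : c ∈ Ioo 0 b)
    (hg : ∀ y ∈ Ioo 0 c, y ^ 2 / 6 < N y) {d : ℝ} (hd : d ∈ Ioc 0 c) (hNd : N d = 1 / 3)
    (hN : ∀ y ∈ Ioo 0 d, N y ≤ 1 / 3) : 1 / 3 ≤ N c := by
  have h := nonneg_of_deriv_nonneg_of_neg (g := fun t => N t - 1 / 3)
    (g' := fun t => (P t - N t) / t) hd.2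
    ((hF.contN_Icc hc.2 hd.1.le).sub continuousOn_const) ?_ (by norm_num [hNd]) ?_
  · linarith
  · intro t ht
    exact (hF.derivN t ⟨hd.1.trans ht.1, ht.2.trans hc.2⟩).sub_const _
  · intro t ht hneg
    have ht0 : 0 < t := hd.1.trans ht.1
    have hP := hF.late_le_P ⟨ht0, ht.2.trans hc.2⟩ (fun y hy => hg y ⟨hy.1, hy.2.trans ht.2⟩)
      ⟨hd.1, ht.1.le⟩ hNd hN
    apply div_nonneg _ ht0.le
    nlinarith

/-- Either the flow is still in its early phase, or `N` has already crossed `1 / 3`. -/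
lemma early_or_late (hF : ReducedFlow N P b) (hc : c ∈ Ioo 0 b) :
    (∀ y ∈ Ioc 0 c, N y ≤ 1 / 3) ∨
      ∃ d ∈ Ioc 0 c, N d = 1 / 3 ∧ ∀ y ∈ Ioo 0 d, N y ≤ 1 / 3 := by
  by_cases h : ∀ y ∈ Ioc 0 c, N y ≤ 1 / 3
  · exact Or.inl h
  · push Not at h
    obtain ⟨y, hy, hNy⟩ := h
    obtain ⟨d, hd, hNd, hlt⟩ := exists_first_hit hy.1.le
      (hF.contN_Icc (hy.2.trans_lt hc.2) le_rfl) (by norm_num [hF.N_zero]) hNy.le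
    exact Or.inr ⟨d, ⟨hd.1, hd.2.trans hy.2⟩, hNd, fun z hz => (hlt z ⟨hz.1.le, hz.2⟩).le⟩

lemma lt_N (hF : ReducedFlow N P b) {y : ℝ} (hy : y ∈ Ioo 0 b) : y ^ 2 / 6 < N y := by
  by_contra! hle
  obtain ⟨k, hk, δ, hδ, hs⟩ := hF.exists_quadratic_le (hy.1.trans hy.2)
  have hsmall : ∀ t ∈ Ioc 0 δ, t ^ 2 / 6 < N t := by
    intro t ht
    have h2 : 0 < t ^ 2 := by have := ht.1; positivity
    nlinarith [hs t ht]
  have hδy : δ < y := by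
    by_contra! h
    linarith [hsmall y ⟨hy.1, h⟩]
  obtain ⟨c, hc, hNc, hlt⟩ := exists_first_hit (f := fun t => t ^ 2 / 6 - N t) (v := 0) hδy.le
    ((by fun_prop : ContinuousOn (fun t : ℝ => t ^ 2 / 6) _).sub (hF.contN_Icc hy.2 hδ.1.le))
    (by linarith [hsmall δ ⟨hδ.1, le_rfl⟩]) (by linarith)
  have hcb : c ∈ Ioo 0 b := ⟨hδ.1.trans hc.1, hc.2.trans_lt hy.2⟩
  have hg : ∀ t ∈ Ioo 0 c, t ^ 2 / 6 < N t := by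
    intro t ht
    rcases le_total t δ with h | h
    · exact hsmall t ⟨ht.1, h⟩
    · linarith [hlt t ⟨h, ht.2⟩]
  have : c ^ 2 / 6 < N c := by
    rcases hF.early_or_late hcb with h | ⟨d, hd, hNd, h⟩
    · exact hF.early_lt_N hcb h
    · have h1 := hF.late_le_N hcb hg hd hNd h
      have h2 := hF.A_pos c hcb
      linarith
  linarith

lemma le_P (hF : ReducedFlow N P b) {y : ℝ} (hy : y ∈ Ioo 0 b) : y ^ 2 / 14 ≤ P y := by
  have hA := hF.A_pos y hy
  have hN := hF.lt_N hy
  rcases hF.early_or_late hy with h | ⟨d, hd, hNd, h⟩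
  · have h1 := hF.early_le_P hy fun z hz => h z ⟨hz.1, hz.2.le⟩
    have h2 := h y ⟨hy.1, le_rfl⟩
    nlinarith [sq_nonneg y]
  · have h1 := hF.late_le_P hy (fun z hz => hF.lt_N ⟨hz.1, hz.2.trans hy.2⟩) hd hNd h
    have h2 := hF.N_pos hy
    nlinarith [sq_nonneg (59 / 100 - N y)]

end ReducedFlow

namespace IsLimitOrbit

variable {A C : ℝ → ℝ} {α b : ℝ}

lemma A_pos (h : IsLimitOrbit A C α (Ico 0 b)) {y : ℝ} (hy : y ∈ Ico 0 b) : 0 < A y := by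
  rcases hy.1.eq_or_lt with rfl | hy0
  · rw [h.2.2.2.2.1]; exact one_pos
  · exact (h.2.1 y ⟨hy, hy0.ne'⟩).2.1

lemma C_pos (h : IsLimitOrbit A C α (Ico 0 b)) (hα : 1 < α) {y : ℝ} (hy : y ∈ Ico 0 b) :
    0 < C y := by
  rcases hy.1.eq_or_lt with rfl | hy0
  · rw [h.2.2.2.2.2]; linarith
  · exact (h.2.1 y ⟨hy, hy0.ne'⟩).2.2.1

lemma hasDerivAt_A (h : IsLimitOrbit A C α (Ico 0 b)) {y : ℝ} (hy : y ∈ Ioo 0 b) :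
    HasDerivAt A ((1 - A y) / y - y * (1 + A y * C y ^ 2)) y := by
  obtain ⟨-, -, -, hA, -, hA', -⟩ := h.2.1 y ⟨⟨hy.1.le, hy.2⟩, hy.1.ne'⟩
  exact hA' ▸ hA.hasDerivAt

lemma hasDerivAt_C (h : IsLimitOrbit A C α (Ico 0 b)) {y : ℝ} (hy : y ∈ Ioo 0 b) :
    HasDerivAt C (C y / (y * A y) * (A y - 1 + y ^ 2)) y := by
  obtain ⟨-, -, -, -, hC, -, hC'⟩ := h.2.1 y ⟨⟨hy.1.le, hy.2⟩, hy.1.ne'⟩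
  exact hC' ▸ hC.hasDerivAt

lemma continuousOn_A (h : IsLimitOrbit A C α (Ico 0 b)) : ContinuousOn A (Ico 0 b) := by
  intro y hy
  rcases hy.1.eq_or_lt with rfl | hy0
  · exact h.2.2.1
  · exact (h.hasDerivAt_A ⟨hy0, hy.2⟩).continuousAt.continuousWithinAt

lemma continuousOn_C (h : IsLimitOrbit A C α (Ico 0 b)) : ContinuousOn C (Ico 0 b) := by
  intro y hy
  rcases hy.1.eq_or_lt with rfl | hy0
  · exact h.2.2.2.1
  · exact (h.hasDerivAt_C ⟨hy0, hy.2⟩).continuousAt.continuousWithinAt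

lemma reducedFlow (h : IsLimitOrbit A C α (Ico 0 b)) (hα : 1 < α) (hb : 0 < b) :
    ReducedFlow (fun y => 1 - A y - y ^ 2 / 3) (fun y => y ^ 2 * (A y * C y ^ 2)) b where
  contN := (continuousOn_const.sub h.continuousOn_A).sub (by fun_prop)
  contP := (by fun_prop : ContinuousOn (fun y : ℝ => y ^ 2) _).mul
    (h.continuousOn_A.mul (h.continuousOn_C.pow 2))
  N_zero := by simp [h.2.2.2.2.1]
  P_zero := by simp
  A_pos y hy := by
    have := h.A_pos ⟨hy.1.le, hy.2⟩
    linarith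
  P_pos y hy := by
    have := h.A_pos ⟨hy.1.le, hy.2⟩
    have := h.C_pos hα ⟨hy.1.le, hy.2⟩
    have := hy.1
    positivity
  derivN y hy := by
    have hy0 := hy.1
    refine (((h.hasDerivAt_A hy).const_sub 1).sub ((hasDerivAt_pow 2 y).div_const 3)).congr_deriv ?_
    field_simp; norm_num; ring
  derivP y hy := by
    have hy0 := hy.1
    have hA := h.A_pos ⟨hy.1.le, hy.2⟩
    refine ((hasDerivAt_pow 2 y).mul
      ((h.hasDerivAt_A hy).mul ((h.hasDerivAt_C hy).pow 2))).congr_deriv ?_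
    have e : 1 - (1 - A y - y ^ 2 / 3) - y ^ 2 / 3 = A y := by ring
    rw [e]
    simp only [Pi.mul_apply, Pi.pow_apply]
    field_simp; norm_num; ring
  start := by
    refine ⟨(1 + α ^ 2) / 6, by nlinarith, ?_⟩
    have hlim : ContinuousWithinAt (fun y => A y * C y ^ 2) (Ico 0 b) 0 :=
      h.2.2.1.mul (h.2.2.2.1.pow 2)
    have hev : ∀ᶠ y in 𝓝[Ico 0 b] 0, (1 + α ^ 2) / 2 < A y * C y ^ 2 := by
      refine hlim.eventually (lt_mem_nhds ?_)
      simp only [h.2.2.2.2.1, h.2.2.2.2.2]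
      nlinarith
    rw [← nhdsWithin_Ioo_eq_nhdsGT hb]
    filter_upwards [nhdsWithin_mono _ Ioo_subset_Ico_self hev] with y hy
    nlinarith [sq_nonneg y]

end IsLimitOrbit

/-- The primitive of the integrand, corrected by the boundary term `t / C t`. -/
def correctedIntegral (A C : ℝ → ℝ) (t : ℝ) : ℝ :=
  (∫ y in (0 : ℝ)..t, y ^ 2 * (1 - A y * C y ^ 2) / (A y * C y)) + t / C t

namespace IsLimitOrbit

variable {A C : ℝ → ℝ} {α b : ℝ}

lemma continuousOn_integrand (h : IsLimitOrbit A C α (Ico 0 b)) (hα : 1 < α) :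
    ContinuousOn (fun y => y ^ 2 * (1 - A y * C y ^ 2) / (A y * C y)) (Ico 0 b) :=
  ((by fun_prop : ContinuousOn (fun y : ℝ => y ^ 2) _).mul
    (continuousOn_const.sub (h.continuousOn_A.mul (h.continuousOn_C.pow 2)))).div
    (h.continuousOn_A.mul h.continuousOn_C)
    fun _ hy => (mul_pos (h.A_pos hy) (h.C_pos hα hy)).ne'

lemma hasDerivAt_id_div_C (h : IsLimitOrbit A C α (Ico 0 b)) (hα : 1 < α) {t : ℝ}
    (ht : t ∈ Ioo 0 b) : HasDerivAt (fun t => t / C t) ((1 - t ^ 2) / (A t * C t)) t := by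
  have hA := h.A_pos ⟨ht.1.le, ht.2⟩
  have hC := h.C_pos hα ⟨ht.1.le, ht.2⟩
  have ht0 := ht.1
  refine ((hasDerivAt_id t).div (h.hasDerivAt_C ht) hC.ne').congr_deriv ?_
  simp only [id]; field_simp; ring

lemma hasDerivAt_correctedIntegral (h : IsLimitOrbit A C α (Ico 0 b)) (hα : 1 < α) {t : ℝ}
    (ht : t ∈ Ioo 0 b) :
    HasDerivAt (correctedIntegral A C) ((1 - t ^ 2 * (A t * C t ^ 2)) / (A t * C t)) t := by
  have hG := h.continuousOn_integrand hα
  have hint : IntervalIntegrable (fun y => y ^ 2 * (1 - A y * C y ^ 2) / (A y * C y)) volume 0 t :=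
    (hG.mono fun y hy => by
      rw [uIcc_of_le ht.1.le] at hy
      exact ⟨hy.1, hy.2.trans_lt ht.2⟩).intervalIntegrable
  have hcont := hG.mono Ioo_subset_Ico_self
  refine ((intervalIntegral.integral_hasDerivAt_right hint
    (hcont.stronglyMeasurableAtFilter isOpen_Ioo t ht)
    (hcont.continuousAt (isOpen_Ioo.mem_nhds ht))).add
    (h.hasDerivAt_id_div_C hα ht)).congr_deriv ?_
  rw [← add_div]
  congr 1
  ring

lemma continuousOn_correctedIntegral (h : IsLimitOrbit A C α (Ico 0 b)) (hα : 1 < α) {t : ℝ}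
    (ht : t ∈ Ioo 0 b) : ContinuousOn (correctedIntegral A C) (Icc 0 t) := by
  have hsub : Icc 0 t ⊆ Ico 0 b := fun y hy => ⟨hy.1, hy.2.trans_lt ht.2⟩
  refine ContinuousOn.add ?_ (continuousOn_id.div (h.continuousOn_C.mono hsub)
    fun y hy => (h.C_pos hα (hsub hy)).ne')
  have := intervalIntegral.continuousOn_primitive_interval (μ := volume) (a := 0) (b := t)
    (f := fun y => y ^ 2 * (1 - A y * C y ^ 2) / (A y * C y))
    (by
      rw [uIcc_of_le ht.1.le]
      exact ((h.continuousOn_integrand hα).mono hsub).integrableOn_Icc)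
  rwa [uIcc_of_le ht.1.le] at this

lemma monotoneOn_correctedIntegral (h : IsLimitOrbit A C α (Ico 0 b)) (hα : 1 < α) (hb : 0 < b) :
    MonotoneOn (correctedIntegral A C) (Ioo 0 b) := by
  have hF := h.reducedFlow hα hb
  refine monotoneOn_of_hasDerivWithinAt_nonneg (convex_Ioo 0 b)
    (fun t ht => (h.hasDerivAt_correctedIntegral hα ht).continuousAt.continuousWithinAt)
    (f' := fun t => (1 - t ^ 2 * (A t * C t ^ 2)) / (A t * C t)) ?_ ?_ <;>
  rw [interior_Ioo]
  · exact fun t ht => (h.hasDerivAt_correctedIntegral hα ht).hasDerivWithinAt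
  · intro t ht
    have hA := h.A_pos ⟨ht.1.le, ht.2⟩
    have hC := h.C_pos hα ⟨ht.1.le, ht.2⟩
    have hP := hF.P_le_one ht fun y hy => hF.lt_N ⟨hy.1, hy.2.trans ht.2⟩
    exact div_nonneg (by linarith) (by positivity)

lemma exists_correctedIntegral_pos (h : IsLimitOrbit A C α (Ico 0 b)) (hα : 1 < α) (hb : 0 < b) :
    ∃ t ∈ Ioo 0 b, 0 < correctedIntegral A C t := by
  have hF := h.reducedFlow hα hb
  have hev : ∀ᶠ y in 𝓝[>] (0 : ℝ), y ^ 2 * (A y * C y ^ 2) < 1 := by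
    have hc : ContinuousWithinAt (fun y => y ^ 2 * (A y * C y ^ 2)) (Ico 0 b) 0 :=
      hF.contP 0 ⟨le_rfl, hb⟩
    rw [← nhdsWithin_Ioo_eq_nhdsGT hb]
    exact nhdsWithin_mono _ Ioo_subset_Ico_self (hc.eventually (gt_mem_nhds (by norm_num)))
  obtain ⟨δ, hδ, hsub⟩ := mem_nhdsGT_iff_exists_Ioc_subset.1 hev
  have hδ0 : 0 < δ := hδ
  set t := min δ (b / 2) with ht
  have htb : t ∈ Ioo 0 b := ⟨lt_min hδ0 (by linarith), (min_le_right _ _).trans_lt (by linarith)⟩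
  refine ⟨t, htb, ?_⟩
  have hmono : StrictMonoOn (correctedIntegral A C) (Icc 0 t) := by
    refine strictMonoOn_of_deriv_pos (convex_Icc 0 t) (h.continuousOn_correctedIntegral hα htb) ?_
    rw [interior_Icc]
    intro y hy
    have hyb : y ∈ Ioo 0 b := ⟨hy.1, hy.2.trans htb.2⟩
    have hA := h.A_pos ⟨hyb.1.le, hyb.2⟩
    have hC := h.C_pos hα ⟨hyb.1.le, hyb.2⟩
    have hP : y ^ 2 * (A y * C y ^ 2) < 1 := hsub ⟨hy.1, hy.2.le.trans (min_le_left _ _)⟩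
    rw [(h.hasDerivAt_correctedIntegral hα hyb).deriv]
    exact div_pos (by linarith) (by positivity)
  have := hmono ⟨le_rfl, htb.1.le⟩ ⟨htb.1.le, le_rfl⟩ htb.1
  simpa [correctedIntegral] using this

lemma one_lt_of_crash (h : IsLimitOrbit A C α (Ico 0 b)) (hα : 1 < α) (hb : 0 < b)
    (hcrash : Tendsto A (𝓝[<] b) (𝓝 0)) : 1 < b := by
  have hF := h.reducedFlow hα hb
  have hlim : Tendsto (fun y => A y + y ^ 2 / 3) (𝓝[<] b) (𝓝 (0 + b ^ 2 / 3)) :=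
    hcrash.add ((by fun_prop : Continuous fun y : ℝ => y ^ 2 / 3).tendsto b |>.mono_left
      nhdsWithin_le_nhds)
  have hle : (41 / 100 : ℝ) ≤ 0 + b ^ 2 / 3 := by
    refine ge_of_tendsto hlim ?_
    filter_upwards [Ioo_mem_nhdsLT hb] with y hy
    have := hF.N_le hy fun z hz => hF.lt_N ⟨hz.1, hz.2.trans hy.2⟩
    linarith
  nlinarith

lemma bddAbove_correctedIntegral (h : IsLimitOrbit A C α (Ico 0 b)) (hα : 1 < α) (hb : 1 < b) :
    BddAbove (correctedIntegral A C '' Ioo 0 b) := by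
  have hb0 : 0 < b := by linarith
  have hmono := h.monotoneOn_correctedIntegral hα hb0
  obtain ⟨d, hd1, hdb⟩ := exists_between hb
  have hd0 : 0 < d := by linarith
  have hk : 0 < d ^ 2 - 1 := by nlinarith
  have hsub : Ico d b ⊆ Ioo 0 b := fun t ht => ⟨hd0.trans_le ht.1, ht.2⟩
  have hder : ∀ t ∈ Ioo 0 b, HasDerivAt
      (fun t => correctedIntegral A C t + 1 / (d ^ 2 - 1) * (t / C t))
      ((1 - t ^ 2 * (A t * C t ^ 2)) / (A t * C t)
        + 1 / (d ^ 2 - 1) * ((1 - t ^ 2) / (A t * C t))) t := fun t ht =>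
    (h.hasDerivAt_correctedIntegral hα ht).add ((h.hasDerivAt_id_div_C hα ht).const_mul _)
  have hanti : AntitoneOn (fun t => correctedIntegral A C t + 1 / (d ^ 2 - 1) * (t / C t))
      (Ico d b) := by
    refine antitoneOn_of_hasDerivWithinAt_nonpos (convex_Ico d b)
      (fun t ht => (hder t (hsub ht)).continuousAt.continuousWithinAt)
      (fun t ht => (hder t (hsub (interior_subset ht))).hasDerivWithinAt) ?_
    intro t ht
    have htd := interior_subset ht
    have htb := hsub htd
    have hA := h.A_pos ⟨htb.1.le, htb.2⟩
    have hC := h.C_pos hα ⟨htb.1.le, htb.2⟩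
    have e : (1 - t ^ 2 * (A t * C t ^ 2)) / (A t * C t)
        + 1 / (d ^ 2 - 1) * ((1 - t ^ 2) / (A t * C t))
        = -(t ^ 2 * (A t * C t ^ 2) + (t ^ 2 - d ^ 2) / (d ^ 2 - 1)) / (A t * C t) := by
      field_simp; ring
    rw [e]
    have : 0 ≤ t ^ 2 - d ^ 2 := by nlinarith [htd.1]
    apply div_nonpos_of_nonpos_of_nonneg _ (by positivity)
    have : 0 ≤ t ^ 2 * (A t * C t ^ 2) + (t ^ 2 - d ^ 2) / (d ^ 2 - 1) := by positivity
    linarith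
  refine ⟨correctedIntegral A C d + 1 / (d ^ 2 - 1) * (d / C d), ?_⟩
  rintro _ ⟨t, ht, rfl⟩
  have hd : d ∈ Ico d b := ⟨le_rfl, hdb⟩
  have hle : ∀ t ∈ Ico d b, correctedIntegral A C t
      ≤ correctedIntegral A C d + 1 / (d ^ 2 - 1) * (d / C d) := by
    intro t ht
    have hC := h.C_pos hα ⟨(hsub ht).1.le, ht.2⟩
    have ht0 := (hsub ht).1
    have h1 := hanti hd ht ht.1
    have h2 : 0 ≤ 1 / (d ^ 2 - 1) * (t / C t) := by positivity
    simp only at h1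
    linarith
  rcases le_total d t with hdt | hdt
  · exact hle t ⟨hdt, ht.2⟩
  · exact (hmono ht (hsub hd) hdt).trans (hle d hd)

lemma tendsto_id_div_C (h : IsLimitOrbit A C α (Ico 0 b)) (hα : 1 < α) (hb : 0 < b)
    (hcrash : Tendsto A (𝓝[<] b) (𝓝 0)) : Tendsto (fun t => t / C t) (𝓝[<] b) (𝓝 0) := by
  have hF := h.reducedFlow hα hb
  have hlim : Tendsto (fun t => b * √(14 * A t)) (𝓝[<] b) (𝓝 0) := by
    have := ((hcrash.const_mul 14).sqrt).const_mul b
    simpa using this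
  refine squeeze_zero' ?_ ?_ hlim <;> filter_upwards [Ioo_mem_nhdsLT hb] with t ht
  · exact div_nonneg ht.1.le (h.C_pos hα ⟨ht.1.le, ht.2⟩).le
  · have hC := h.C_pos hα ⟨ht.1.le, ht.2⟩
    have ht0 := ht.1
    have hP := hF.le_P ht
    have h1 : 1 ≤ 14 * A t * C t ^ 2 := by
      have ht2 : 0 < t ^ 2 := by positivity
      have : t ^ 2 * 1 ≤ t ^ 2 * (14 * A t * C t ^ 2) := by linarith
      exact le_of_mul_le_mul_left this ht2
    have h2 : 1 / C t ≤ √(14 * A t) := by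
      apply Real.le_sqrt_of_sq_le
      rw [div_pow, one_pow, div_le_iff₀ (by positivity)]
      exact h1
    calc t / C t = t * (1 / C t) := by ring
      _ ≤ b * √(14 * A t) := mul_le_mul ht.2.le h2 (by positivity) hb.le

end IsLimitOrbit

/-- For a solution of the limiting system on `[0, ȳ)` crashing at `ȳ`
(`A > 0` before `ȳ` and `A → 0` at `ȳ⁻`), the improper integral
`∫₀^ȳ y² (1 − A C²)/(A C) dy` converges to a strictly positive value. -/
theorem limit_integral_positive (α : ℝ) (hα : 1 < α) (A C : ℝ → ℝ) (ybar : ℝ)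
    (hybar : 0 < ybar) (horbit : IsLimitOrbit A C α (Set.Ico 0 ybar))
    (hcrash : Filter.Tendsto A (nhdsWithin ybar (Set.Iio ybar)) (nhds 0)) :
    ∃ I : ℝ, 0 < I ∧
      Filter.Tendsto
        (fun t => ∫ y in (0 : ℝ)..t, y ^ 2 * (1 - A y * C y ^ 2) / (A y * C y))
        (nhdsWithin ybar (Set.Iio ybar)) (nhds I) := by
  have hmono := horbit.monotoneOn_correctedIntegral hα hybar
  have hbdd := horbit.bddAbove_correctedIntegral hα (horbit.one_lt_of_crash hα hybar hcrash)
  obtain ⟨t, ht, hpos⟩ := horbit.exists_correctedIntegral_pos hα hybar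
  refine ⟨sSup (correctedIntegral A C '' Ioo 0 ybar),
    hpos.trans_le (le_csSup hbdd (mem_image_of_mem _ ht)), ?_⟩
  have hlim := (hmono.tendsto_nhdsWithin_Ioo_left ⟨t, ht⟩ hbdd).sub
    (horbit.tendsto_id_div_C hα hybar hcrash)
  simpa [correctedIntegral] using hlim
end
end

section
/- Let (f, A, C) be an a-orbit of the mini-boson-star system with parameters a > 0, α > 1, defined for all x ≥ 0, with (f(x), f'(x)) ≠ (0, 0) for all x, whose rotation function θ is bounded above. Then the orbit is ultimately in the second or fourth quadrant of the (f, f')-plane: there exists x₂ such that f(x)·f'(x) < 0 for all x > x₂. -/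
open Real Set Filter Topology MeasureTheory

noncomputable section

/-- A function that can only cross zero downwards has eventually constant strict sign. -/
theorem eventually_sign_of_deriv_neg_at_zeros {g g' : ℝ → ℝ} {X : ℝ}
    (hg : ∀ x, X < x → HasDerivAt g (g' x) x)
    (hneg : ∀ x, X < x → g x = 0 → g' x < 0) :
    ∃ Y, X ≤ Y ∧ ((∀ x, Y < x → g x < 0) ∨ ∀ x, Y < x → 0 < g x) := by
  by_cases hpos : ∀ x, X < x → 0 < g x
  · exact ⟨X, le_rfl, Or.inr hpos⟩
  push Not at hpos
  obtain ⟨x₀, hx₀, hgx₀⟩ := hpos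
  have hle : ∀ x, x₀ ≤ x → g x ≤ 0 := fun x hx =>
    image_le_of_deriv_right_lt_deriv_boundary (B := fun _ => 0) (B' := fun _ => 0)
      (fun y hy => (hg y (hx₀.trans_le hy.1)).continuousAt.continuousWithinAt)
      (fun y hy => (hg y (hx₀.trans_le hy.1)).hasDerivWithinAt) hgx₀
      (fun y => hasDerivAt_const y 0)
      (fun y hy => hneg y (hx₀.trans_le hy.1)) ⟨hx, le_rfl⟩
  refine ⟨x₀, hx₀.le, Or.inl fun x hx => (hle x hx.le).lt_of_ne fun h0 => ?_⟩
  have hmax : IsLocalMax g x := by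
    filter_upwards [Ioi_mem_nhds hx] with y hy
    rw [h0]
    exact hle y (le_of_lt hy)
  exact (hneg x (hx₀.trans hx) h0).ne (hmax.hasDerivAt_eq_zero (hg x (hx₀.trans hx)))

/-- At a zero of the cosine of the angle, the orbit rotates with `θ` strictly increasing. -/
theorem IsRotation.eventually_lt_and_gt {f θ : ℝ → ℝ} (hθ : IsRotation f θ (Ici 0))
    {x : ℝ} (hx : 0 < x) (hf : DifferentiableAt ℝ f x) (hcos : Real.cos (θ x) = 0) :
    (∀ᶠ y in 𝓝[>] x, θ x < θ y) ∧ ∀ᶠ y in 𝓝[<] x, θ y < θ x := by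
  obtain ⟨hcont, -, hpol⟩ := hθ
  have hθx : ContinuousAt θ x := hcont.continuousAt (Ici_mem_nhds hx)
  obtain ⟨ρ, hρ, hfx, hdx⟩ := hpol x hx.le
  have hsin : Real.sin (θ x) ^ 2 = 1 := by
    have := Real.sin_sq_add_cos_sq (θ x)
    rw [hcos] at this
    linarith
  have hfx0 : f x = 0 := by rw [hfx, hcos, mul_zero]
  have hd : HasDerivAt (fun y => f y * deriv f x) (deriv f x * deriv f x) x :=
    hf.hasDerivAt.mul_const _
  have hdpos : 0 < deriv f x * deriv f x := by
    have : deriv f x * deriv f x = ρ ^ 2 * Real.sin (θ x) ^ 2 := by rw [hdx]; ring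
    rw [this, hsin]
    positivity
  have hslope := (hasDerivAt_iff_tendsto_slope.mp hd).eventually (lt_mem_nhds hdpos)
  have hnear : ∀ᶠ y in 𝓝 x, |θ y - θ x| < π := by
    have := hθx.tendsto.eventually (Metric.ball_mem_nhds (θ x) Real.pi_pos)
    filter_upwards [this] with y hy
    simpa [Real.dist_eq] using hy
  have hkey : ∀ y, 0 < y → ∃ r > 0, f y * deriv f x = r * Real.sin (θ y - θ x) := by
    intro y hy
    obtain ⟨r, hr, hfy, -⟩ := hpol y hy.le
    refine ⟨r * ρ, by positivity, ?_⟩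
    rw [hfy, hdx, Real.sin_sub, hcos]
    ring
  have hslope_eq : ∀ y, slope (fun y => f y * deriv f x) x y
      = (y - x)⁻¹ * (f y * deriv f x) := by
    intro y
    simp [slope_def_field, hfx0, div_eq_inv_mul]
  constructor
  · have h1 : ∀ᶠ y in 𝓝[>] x, 0 < slope (fun y => f y * deriv f x) x y :=
      hslope.filter_mono (nhdsWithin_mono x fun y hy => ne_of_gt hy)
    filter_upwards [h1, nhdsWithin_le_nhds hnear, self_mem_nhdsWithin] with y hs hn hy
    have hxy : 0 < y - x := sub_pos.mpr hy
    obtain ⟨r, hr, hre⟩ := hkey y (hx.trans hy)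
    rw [hslope_eq, hre] at hs
    have hsp : 0 < Real.sin (θ y - θ x) :=
      pos_of_mul_pos_right (pos_of_mul_pos_right hs (inv_nonneg.mpr hxy.le)) hr.le
    by_contra! hle
    exact hsp.not_ge (Real.sin_nonpos_of_nonpos_of_neg_pi_le (by linarith)
      (by linarith [(abs_lt.mp hn).1]))
  · have h1 : ∀ᶠ y in 𝓝[<] x, 0 < slope (fun y => f y * deriv f x) x y :=
      hslope.filter_mono (nhdsWithin_mono x fun y hy => ne_of_lt hy)
    filter_upwards [h1, nhdsWithin_le_nhds hnear, self_mem_nhdsWithin,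
      nhdsWithin_le_nhds (Ioi_mem_nhds hx)] with y hs hn hy hy0
    have hxy : y - x < 0 := sub_neg.mpr hy
    obtain ⟨r, hr, hre⟩ := hkey y hy0
    rw [hslope_eq, hre] at hs
    have h2 : r * Real.sin (θ y - θ x) < 0 := by
      by_contra! hge
      exact hs.not_ge (mul_nonpos_of_nonpos_of_nonneg (inv_nonpos.mpr hxy.le) hge)
    by_contra! hle
    exact h2.not_ge (mul_nonneg hr.le (Real.sin_nonneg_of_nonneg_of_le_pi (by linarith)
      (by linarith [(abs_lt.mp hn).2])))

/-- If the rotation function is bounded above then the scalar field is eventually nonzero. -/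
theorem IsRotation.eventually_ne_zero {f θ : ℝ → ℝ} (hθ : IsRotation f θ (Ici 0))
    (hf : ∀ x, 0 < x → DifferentiableAt ℝ f x)
    (hbd : ∃ K : ℝ, ∀ x ∈ Ici (0 : ℝ), θ x ≤ K) :
    ∃ X, 0 < X ∧ ∀ x, X < x → f x ≠ 0 := by
  obtain ⟨K, hK⟩ := hbd
  have hcos : ∀ k : ℤ, Real.cos ((2 * k + 1) * π / 2) = 0 := fun k =>
    Real.cos_eq_zero_iff.mpr ⟨k, rfl⟩
  obtain ⟨k, ⟨x₀, hx₀, hk⟩, hmax⟩ := Int.exists_greatest_of_bdd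
    (P := fun k : ℤ => ∃ x, 1 ≤ x ∧ (2 * k + 1) * π / 2 ≤ θ x)
    (by
      obtain ⟨n, hn⟩ := exists_int_gt (K / π)
      refine ⟨n, fun z ⟨x, hx, hz⟩ => ?_⟩
      have h1 := hz.trans (hK x (by simp only [mem_Ici]; linarith))
      have h2 : K < n * π := (div_lt_iff₀ Real.pi_pos).mp hn
      have h3 : ((z : ℝ) - n) * π < 0 := by nlinarith [Real.pi_pos]
      have h4 : (z : ℝ) - n < 0 := by
        by_contra! h
        exact h3.not_ge (mul_nonneg h Real.pi_pos.le)
      exact_mod_cast (sub_neg.mp h4).le)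
    (by
      obtain ⟨n, hn⟩ := exists_int_lt (θ 1 / π - 1)
      refine ⟨n, 1, le_rfl, ?_⟩
      have h2 : (n + 1 : ℝ) * π < θ 1 := (lt_div_iff₀ Real.pi_pos).mp (by linarith)
      nlinarith [Real.pi_pos])
  have hge : ∀ x, x₀ ≤ x → (2 * k + 1) * π / 2 ≤ θ x := by
    intro x hx
    have hsub : Icc x₀ x ⊆ {y | (2 * k + 1) * π / 2 ≤ θ y} := by
      have hc : ContinuousOn θ (Icc x₀ x) :=
        hθ.1.mono fun y hy => le_trans (by linarith) hy.1
      refine IsClosed.Icc_subset_of_forall_mem_nhdsWithin ?_ hk ?_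
      · rw [inter_comm]
        exact hc.preimage_isClosed_of_isClosed isClosed_Icc isClosed_Ici
      · rintro y ⟨hy, hy₀, -⟩
        have hy0 : 0 < y := by linarith
        rcases (show (2 * k + 1) * π / 2 ≤ θ y from hy).eq_or_lt with h | h
        · have hcy : Real.cos (θ y) = 0 := by rw [← h]; exact hcos k
          filter_upwards [(hθ.eventually_lt_and_gt hy0 (hf y hy0) hcy).1] with z hz
          exact h.le.trans hz.le
        · have hθy : ContinuousAt θ y := hθ.1.continuousAt (Ici_mem_nhds hy0)
          filter_upwards [nhdsWithin_le_nhds (hθy.tendsto.eventually (lt_mem_nhds h))] with z hz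
          exact le_of_lt hz
    exact hsub ⟨hx, le_rfl⟩
  refine ⟨x₀, by linarith, fun x hx hfx => ?_⟩
  have hx0 : 0 < x := by linarith
  obtain ⟨ρ, hρ, hfρ, -⟩ := hθ.2.2 x hx0.le
  have hcx : Real.cos (θ x) = 0 := by
    rw [hfx] at hfρ
    exact (mul_eq_zero.mp hfρ.symm).resolve_left hρ.ne'
  obtain ⟨m, hm⟩ := Real.cos_eq_zero_iff.mp hcx
  have hmk : m ≤ k := hmax m ⟨x, by linarith, hm.ge⟩
  have hmk' : (m : ℝ) ≤ k := by exact_mod_cast hmk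
  have hθle : θ x ≤ (2 * k + 1) * π / 2 := by
    rw [hm]
    nlinarith [Real.pi_pos]
  have hev := (hθ.eventually_lt_and_gt hx0 (hf x hx0) hcx).2
  obtain ⟨y, hy, hyx⟩ := (hev.and (Ioo_mem_nhdsLT hx)).exists
  linarith [hge y hyx.1.le]

section System

variable {f A C : ℝ → ℝ} {s : Set ℝ} {x : ℝ}

theorem MiniBosonSystem.hasDerivAt_massFn (h : MiniBosonSystem f A C s) (hx : x ∈ s) :
    HasDerivAt (massFn A)
      (x ^ 2 / 2 * (A x * deriv f x ^ 2 + A x * C x ^ 2 * f x ^ 2 + f x ^ 2)) x := by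
  obtain ⟨hx0, -, -, -, -, hA, -, -, hA', -⟩ := h x hx
  have h1 : HasDerivAt (massFn A) ((1 * (1 - A x) + x * (-deriv A x)) / 2) x :=
    ((hasDerivAt_id x).mul (hA.hasDerivAt.const_sub 1)).div_const 2
  refine h1.congr_deriv ?_
  rw [hA']
  field_simp
  ring

theorem MiniBosonSystem.hasDerivAt_mul_sq (h : MiniBosonSystem f A C s) (hx : x ∈ s) :
    HasDerivAt (fun y => A y * C y ^ 2)
      (C x ^ 2 / x * (-(1 - A x) + x ^ 2 * f x ^ 2 * (1 - A x * C x ^ 2)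
        - A x * x ^ 2 * deriv f x ^ 2)) x := by
  obtain ⟨hx0, hApos, -, -, -, hA, hC, -, hA', hC'⟩ := h x hx
  have h1 := hA.hasDerivAt.mul (hC.hasDerivAt.pow 2)
  refine h1.congr_deriv ?_
  simp only [Pi.pow_apply]
  rw [hA', hC']
  field_simp
  ring

theorem MiniBosonSystem.deriv_deriv_of_deriv_eq_zero (h : MiniBosonSystem f A C s)
    (hx : x ∈ s) (hfx : deriv f x = 0) :
    deriv (deriv f) x = (1 - A x * C x ^ 2) / A x * f x := by
  obtain ⟨hx0, hApos, hCpos, -, hf', -, hC, hode, -, -⟩ := h x hx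
  have h1 := (((hasDerivAt_id x).pow 2).mul hf'.hasDerivAt).div hC.hasDerivAt hCpos.ne'
  have h2 : deriv (fun y => y ^ 2 * deriv f y / C y) x = _ := h1.deriv
  rw [hode] at h2
  simp only [Pi.mul_apply, Pi.pow_apply, id, hfx] at h2
  simp only [mul_zero, zero_add, zero_mul, sub_zero] at h2
  field_simp at h2
  field_simp
  linarith

end System

/-- On a global orbit `f²` cannot be eventually bounded below by a positive constant:
the mass would outgrow `x / 2`. -/
theorem MiniBosonSystem.not_sq_bounded_below {f A C : ℝ → ℝ}
    (h : MiniBosonSystem f A C (Ioi 0)) {X c : ℝ} (hX : 0 < X) (hc : 0 < c)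
    (hM : ∀ x, 0 < x → 0 ≤ massFn A x) : ¬ ∀ x, X ≤ x → c ≤ f x ^ 2 := by
  intro hf
  set Z := X + 2 / c + 1 with hZ
  have hcpos : 0 < 2 / c := by positivity
  have hZX : X ≤ Z := by linarith
  have hZ0 : 0 < Z := by linarith
  have hZ1 : 1 ≤ Z := by linarith
  have hZc : 2 ≤ Z * c := by
    have : 2 / c * c = 2 := by field_simp
    nlinarith
  have hd : ∀ x, 0 < x → HasDerivAt (fun y => massFn A y - y) _ x := fun x hx =>
    (h.hasDerivAt_massFn hx).sub (hasDerivAt_id x)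
  have hmono : MonotoneOn (fun y => massFn A y - y) (Ici Z) := by
    refine monotoneOn_of_deriv_nonneg (convex_Ici Z)
      (fun y hy => (hd y (hZ0.trans_le hy)).continuousAt.continuousWithinAt)
      (fun y hy => (hd y (hZ0.trans_le (interior_subset hy))).differentiableAt.differentiableWithinAt)
      fun y hy => ?_
    have hy' : Z ≤ y := interior_subset hy
    have hy0 : 0 < y := hZ0.trans_le hy'
    rw [(hd y hy0).deriv]
    have hApos := (h y hy0).2.1
    have h1 : c ≤ f y ^ 2 := hf y (hZX.trans hy')
    have h2 : c ≤ A y * deriv f y ^ 2 + A y * C y ^ 2 * f y ^ 2 + f y ^ 2 := by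
      have : 0 ≤ A y * deriv f y ^ 2 + A y * C y ^ 2 * f y ^ 2 := by positivity
      linarith
    have h3 : y ^ 2 / 2 * c ≤
        y ^ 2 / 2 * (A y * deriv f y ^ 2 + A y * C y ^ 2 * f y ^ 2 + f y ^ 2) := by gcongr
    have h4 : 2 ≤ y * c := hZc.trans (by gcongr)
    nlinarith
  have h1 := hmono self_mem_Ici (show Z ≤ 2 * Z by linarith) (by linarith)
  have h2 := hM Z hZ0
  have h3 : massFn A (2 * Z) < Z := by
    have := mul_pos hZ0 (h (2 * Z) (show 0 < 2 * Z by linarith)).2.1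
    simp only [massFn]
    nlinarith
  simp only at h1
  linarith

theorem IsAOrbit.massFn_nonneg_and_monotone {f A C : ℝ → ℝ} {a α : ℝ}
    (h : IsAOrbit f A C a α (Ici 0)) :
    MonotoneOn (massFn A) (Ici 0) ∧ ∀ x, 0 ≤ x → 0 ≤ massFn A x := by
  obtain ⟨-, hsys, -, hA, -⟩ := h
  rw [Ici_sdiff_left] at hsys
  have hmono : MonotoneOn (massFn A) (Ici 0) := by
    refine monotoneOn_of_deriv_nonneg (convex_Ici 0) (fun y hy => ?_) (fun y hy => ?_)
      fun y hy => ?_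
    · rcases (mem_Ici.mp hy).eq_or_lt with rfl | hy0
      · exact (continuousWithinAt_id.mul (continuousWithinAt_const.sub hA)).div_const 2
      · exact (hsys.hasDerivAt_massFn hy0).continuousAt.continuousWithinAt
    · rw [interior_Ici] at hy
      exact (hsys.hasDerivAt_massFn hy).differentiableAt.differentiableWithinAt
    · rw [interior_Ici] at hy
      rw [(hsys.hasDerivAt_massFn hy).deriv]
      have := (hsys y hy).2.1
      positivity
  refine ⟨hmono, fun x hx => ?_⟩
  have := hmono self_mem_Ici hx hx
  simpa [massFn] using this

/-- An `a`-orbit defined for all `x ≥ 0` whose rotation function is bounded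
above is ultimately in the second or fourth quadrant of the `(f, f')`-plane:
`f · f' < 0` for all sufficiently large `x`. -/
theorem ultimately_Q2_or_Q4 (f A C θ : ℝ → ℝ) (a α : ℝ)
    (ha : 0 < a) (hα : 1 < α)
    (horbit : IsAOrbit f A C a α (Set.Ici 0))
    (hnv : ∀ x ∈ Set.Ici (0 : ℝ), (f x, deriv f x) ≠ (0, 0))
    (hθ : IsRotation f θ (Set.Ici 0))
    (hbd : ∃ K : ℝ, ∀ x ∈ Set.Ici (0 : ℝ), θ x ≤ K) :
    ∃ x₂ : ℝ, ∀ x : ℝ, x₂ < x → f x * deriv f x < 0 := by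
  obtain ⟨hmono, hM⟩ := horbit.massFn_nonneg_and_monotone
  have hsys : MiniBosonSystem f A C (Ioi 0) := by
    simpa only [Ici_sdiff_left] using horbit.2.1
  obtain ⟨X, hX, hfne⟩ := hθ.eventually_ne_zero (fun x hx => (hsys x hx).2.2.2.1) hbd
  have hAlt : ∀ x, X < x → A x < 1 := by
    intro x hx
    have hx0 : 0 < x := hX.trans hx
    by_contra! hge
    have hzero : massFn A x = 0 := by
      refine le_antisymm ?_ (hM x hx0.le)
      simp only [massFn]
      nlinarith
    have hmax : IsLocalMax (massFn A) ((X + x) / 2) := by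
      have hlt : (X + x) / 2 < x := by linarith
      filter_upwards [Iio_mem_nhds hlt, Ioi_mem_nhds (show 0 < (X + x) / 2 by linarith)]
        with y hy hy0
      exact (hmono (mem_Ici.mpr (le_of_lt hy0)) hx0.le (le_of_lt hy)).trans
        (hzero.le.trans (hM _ (by linarith)))
    have hz0 : 0 < (X + x) / 2 := by linarith
    have hderiv := hmax.hasDerivAt_eq_zero (hsys.hasDerivAt_massFn hz0)
    have hApos := (hsys _ hz0).2.1
    have hf2 := sq_pos_of_ne_zero (hfne ((X + x) / 2) (by linarith))
    exact absurd hderiv (by positivity)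
  obtain ⟨Y, hXY, hsign⟩ := eventually_sign_of_deriv_neg_at_zeros
    (g := fun y => A y * C y ^ 2 - 1) (X := X)
    (fun x hx => (hsys.hasDerivAt_mul_sq (hX.trans hx)).sub_const 1)
    (fun x hx h0 => by
      have hx0 : 0 < x := hX.trans hx
      obtain ⟨-, hApos, hCpos, -⟩ := hsys x hx0
      have h1 : 1 - A x * C x ^ 2 = 0 := by linarith
      rw [h1]
      refine mul_neg_of_pos_of_neg (by positivity) ?_
      have h2 : 0 ≤ A x * x ^ 2 * deriv f x ^ 2 := by positivity
      linarith [hAlt x hx])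
  have hY : 0 < Y := hX.trans_le hXY
  have hd : ∀ x, Y < x → HasDerivAt (fun y => f y * deriv f y)
      (deriv f x * deriv f x + f x * deriv (deriv f) x) x := fun x hx => by
    obtain ⟨-, -, -, hf, hf', -⟩ := hsys x (hY.trans hx)
    exact hf.hasDerivAt.mul hf'.hasDerivAt
  have hzero : ∀ x, Y < x → f x * deriv f x = 0 →
      deriv f x * deriv f x + f x * deriv (deriv f) x
        = (1 - A x * C x ^ 2) * (f x ^ 2 / A x) := by
    intro x hx h0
    have hf' : deriv f x = 0 :=
      (mul_eq_zero.mp h0).resolve_left (hfne x (hXY.trans_lt hx))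
    rw [hsys.deriv_deriv_of_deriv_eq_zero (hY.trans hx) hf', hf']
    ring
  have hquot : ∀ x, Y < x → 0 < f x ^ 2 / A x := fun x hx =>
    div_pos (sq_pos_of_ne_zero (hfne x (hXY.trans_lt hx))) (hsys x (hY.trans hx)).2.1
  have hcases : ∃ Z, Y ≤ Z ∧ ((∀ x, Z < x → f x * deriv f x < 0) ∨
      ∀ x, Z < x → 0 < f x * deriv f x) := by
    rcases hsign with hlt | hgt
    · obtain ⟨Z, hYZ, hZ⟩ := eventually_sign_of_deriv_neg_at_zeros
        (fun x hx => (hd x hx).neg) (fun x hx h0 => by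
          rw [hzero x hx (neg_eq_zero.mp h0)]
          exact neg_neg_of_pos (mul_pos (by linarith [hlt x hx]) (hquot x hx)))
      refine ⟨Z, hYZ, hZ.symm.imp (fun h x hx => neg_pos.mp (h x hx))
        (fun h x hx => neg_neg_iff_pos.mp (h x hx))⟩
    · exact eventually_sign_of_deriv_neg_at_zeros hd (fun x hx h0 => by
          rw [hzero x hx h0]
          exact mul_neg_of_neg_of_pos (by linarith [hgt x hx]) (hquot x hx))
  obtain ⟨Z, hYZ, hneg | hpos⟩ := hcases
  · exact ⟨Z, hneg⟩
  exfalso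
  have hfd : ∀ x, Z < x → HasDerivAt (fun y => f y ^ 2) (2 * (f x * deriv f x)) x :=
    fun x hx => ((hsys x (show 0 < x by linarith)).2.2.2.1.hasDerivAt.pow 2).congr_deriv
      (by push_cast; ring)
  have hfmono : MonotoneOn (fun y => f y ^ 2) (Ici (Z + 1)) := by
    refine monotoneOn_of_deriv_nonneg (convex_Ici _)
      (fun y hy => (hfd y ?_).continuousAt.continuousWithinAt)
      (fun y hy => (hfd y ?_).differentiableAt.differentiableWithinAt) fun y hy => ?_
    · linarith [mem_Ici.mp hy]
    · linarith [mem_Ici.mp (interior_subset hy)]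
    · have hy' : Z < y := by linarith [mem_Ici.mp (interior_subset hy)]
      rw [(hfd y hy').deriv]
      linarith [hpos y hy']
  exact hsys.not_sq_bounded_below (X := Z + 1) (by linarith)
    (sq_pos_of_ne_zero (hfne (Z + 1) (by linarith))) (fun x hx => hM x hx.le)
    fun x hx => hfmono self_mem_Ici hx hx
end
end
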